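/- There exists ā ∈ [0, π/2) with the following property: if X = (x, y, z) : ℝ → ℝ³ is the solution of the 1-1-1 ABC flow system with X(0) = (-π/2, 0, ā), then there is t* > 0 such that X(t) ∈ D for all t ∈ (0, t*), x(t*) = 0, z(t*) = π/2, and y(t*) ∈ [-π/2, π/4]. -/

import Mathlib

open Real Set Filter

/-- A solution of the 1-1-1 ABC flow system. -/
def IsABCSol (x y z : ℝ → ℝ) : Prop :=
  ∀ t : ℝ,
    HasDerivAt x (Real.sin (z t) + Real.cos (y t)) t ∧
    HasDerivAt y (Real.sin (x t) + Real.cos (z t)) t ∧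
    HasDerivAt z (Real.sin (y t) + Real.cos (x t)) t

/-- The open triangle `R` in the `xy`-plane with vertices `(0, -π/2)`, `(0, 3π/2)`, `(-π, π/2)`. -/
def triR : Set (ℝ × ℝ) :=
  {p | -(Real.pi / 2) < p.1 + p.2 ∧ p.2 - p.1 < 3 * Real.pi / 2 ∧ p.1 < 0}

/-- The open prism `D = R × (0, π/2)` in `ℝ³`. -/
def prismD : Set (ℝ × ℝ × ℝ) :=
  {p | (p.1, p.2.1) ∈ triR ∧ 0 < p.2.2 ∧ p.2.2 < Real.pi / 2}

open Topology

/-- A function with positive derivative at a zero is positive just after it. -/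
lemma eventually_pos_right_of_hasDerivAt {f : ℝ → ℝ} {c t : ℝ} (hf : HasDerivAt f c t)
    (hc : 0 < c) (h0 : f t = 0) : ∀ᶠ s in 𝓝[>] t, 0 < f s := by
  have h := (hasDerivAt_iff_tendsto_slope.1 hf).mono_left
    (nhdsWithin_mono t (fun s (hs : t < s) => hs.ne'))
  filter_upwards [h.eventually (eventually_gt_nhds hc), self_mem_nhdsWithin] with s hs hts
  rw [slope_def_field, h0, sub_zero] at hs
  exact (div_pos_iff_of_pos_right (sub_pos.2 hts)).1 hs

/-- A function with positive derivative at a zero is negative just before it. -/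
lemma eventually_neg_left_of_hasDerivAt {f : ℝ → ℝ} {c t : ℝ} (hf : HasDerivAt f c t)
    (hc : 0 < c) (h0 : f t = 0) : ∀ᶠ s in 𝓝[<] t, f s < 0 := by
  have h := (hasDerivAt_iff_tendsto_slope.1 hf).mono_left
    (nhdsWithin_mono t (fun s (hs : s < t) => hs.ne))
  filter_upwards [h.eventually (eventually_gt_nhds hc), self_mem_nhdsWithin] with s hs hts
  have hts' : s < t := hts
  rw [slope_def_field, h0, sub_zero] at hs
  by_contra! hn
  exact absurd (div_nonpos_of_nonneg_of_nonpos hn (by linarith : s - t ≤ 0)) (not_le.2 hs)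

/-- The earliest time in `[0, T]` at which a closed condition holds. -/
lemma exists_first_time {p : ℝ → Prop} (hp : IsClosed {t | p t}) {T : ℝ} (hT : 0 ≤ T) (h : p T) :
    ∃ τ ∈ Icc 0 T, p τ ∧ ∀ s ∈ Ico 0 τ, ¬ p s := by
  have hc : IsCompact (Icc 0 T ∩ {t | p t}) := isCompact_Icc.inter_right hp
  obtain ⟨τ, hτ, hmin⟩ := hc.exists_isLeast ⟨T, ⟨hT, le_rfl⟩, h⟩
  refine ⟨τ, hτ.1, hτ.2, fun s hs hps => ?_⟩
  exact absurd (hmin ⟨⟨hs.1, hs.2.le.trans hτ.1.2⟩, hps⟩) (not_le.2 hs.2)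

/-- Barrier principle: a function which starts nonnegative and has positive derivative at each
zero is positive at later times. -/
lemma pos_of_barrier {f f' : ℝ → ℝ} {T : ℝ} (hf : ∀ t, HasDerivAt f (f' t) t) (h0 : 0 ≤ f 0)
    (hb : ∀ t ∈ Icc 0 T, (∀ s ∈ Ioo 0 t, 0 < f s) → f t = 0 → 0 < f' t) :
    ∀ t ∈ Ioc 0 T, 0 < f t := by
  have hcont : Continuous f := continuous_iff_continuousAt.2 fun t => (hf t).continuousAt
  have hstart : ∀ᶠ s in 𝓝[>] (0 : ℝ), s < T → 0 < f s := by
    by_cases hT : 0 ≤ T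
    · rcases h0.eq_or_lt with h | h
      · filter_upwards [eventually_pos_right_of_hasDerivAt (hf 0)
          (hb 0 ⟨le_rfl, hT⟩ (by simp) h.symm) h.symm] with s hs _ using hs
      · filter_upwards [(hcont.tendsto 0).mono_left nhdsWithin_le_nhds
          |>.eventually (eventually_gt_nhds h)] with s hs _ using hs
    · filter_upwards [self_mem_nhdsWithin] with s (hs : 0 < s) hsT
      exact absurd (hs.trans hsT).le hT
  obtain ⟨ε, hε, hεf⟩ := (mem_nhdsGT_iff_exists_Ioo_subset).1 hstart
  have hε' : (0 : ℝ) < ε := hε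
  intro t ht
  by_contra hneg
  have hpre : ∀ s ∈ Ioo 0 ε, s < t → 0 < f s := fun s hs hst => hεf hs (hst.trans_le ht.2)
  have hclosed : IsClosed {s | min (ε / 2) t ≤ s ∧ f s ≤ 0} :=
    (isClosed_le continuous_const continuous_id).inter (isClosed_le hcont continuous_const)
  obtain ⟨τ, hτ, ⟨hετ, hfτ⟩, hmin⟩ :=
    exists_first_time hclosed ht.1.le ⟨min_le_right _ _, not_lt.1 hneg⟩
  have hτ0 : 0 < τ := lt_of_lt_of_le (lt_min (by linarith) ht.1) hετ
  have hbefore : ∀ s ∈ Ioo 0 τ, 0 < f s := by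
    intro s hs
    by_cases hsε : s < ε
    · exact hpre s ⟨hs.1, hsε⟩ (hs.2.trans_le hτ.2)
    · by_contra hn
      exact hmin s ⟨hs.1.le, hs.2⟩ ⟨(min_le_left _ _).trans (by linarith), not_lt.1 hn⟩
  have hfτ0 : f τ = 0 := by
    refine le_antisymm hfτ ?_
    refine ge_of_tendsto ((hcont.tendsto τ).mono_left (nhdsWithin_le_nhds (s := Iio τ))) ?_
    filter_upwards [Ioo_mem_nhdsLT hτ0] with s hs using (hbefore s hs).le
  have hd := hb τ ⟨hτ0.le, hτ.2.trans ht.2⟩ hbefore hfτ0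
  obtain ⟨s, hs, hs'⟩ := ((eventually_neg_left_of_hasDerivAt (hf τ) hd hfτ0).and
    (Ioo_mem_nhdsLT hτ0)).exists
  exact absurd (hbefore s hs') (not_lt.2 hs.le)

/-- A function with nonnegative derivative on `(a, b)` does not decrease from `a` to `b`. -/
lemma le_of_hasDerivAt_nonneg {f f' : ℝ → ℝ} {a b : ℝ} (hf : ∀ t, HasDerivAt f (f' t) t)
    (hab : a ≤ b) (h : ∀ t ∈ Ioo a b, 0 ≤ f' t) : f a ≤ f b := by
  have hm : MonotoneOn f (Icc a b) := by
    refine monotoneOn_of_deriv_nonneg (convex_Icc a b)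
      (fun t _ => (hf t).continuousAt.continuousWithinAt)
      (fun t _ => (hf t).differentiableAt.differentiableWithinAt) fun t ht => ?_
    rw [interior_Icc] at ht
    rw [(hf t).deriv]
    exact h t ht
  exact hm ⟨le_rfl, hab⟩ ⟨hab, le_rfl⟩ hab

/-- A function with positive derivative on `(a, b)` increases strictly from `a` to `b`. -/
lemma lt_of_hasDerivAt_pos {f f' : ℝ → ℝ} {a b : ℝ} (hf : ∀ t, HasDerivAt f (f' t) t)
    (hab : a < b) (h : ∀ t ∈ Ioo a b, 0 < f' t) : f a < f b := by
  have hm : StrictMonoOn f (Icc a b) := by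
    refine strictMonoOn_of_deriv_pos (convex_Icc a b)
      (fun t _ => (hf t).continuousAt.continuousWithinAt) fun t ht => ?_
    rw [interior_Icc] at ht
    rw [(hf t).deriv]
    exact h t ht
  exact hm ⟨le_rfl, hab.le⟩ ⟨hab.le, le_rfl⟩ hab

/-- For a family depending locally uniformly on a parameter, the set of parameters for which `g`
becomes positive while `f` stays negative is open. -/
lemma isOpen_setOf_crosses {α : Type*} [PseudoMetricSpace α] {f g : α → ℝ → ℝ}
    (hfc : ∀ a, Continuous (f a))
    (hf : ∀ a b t, 0 ≤ t → |f a t - f b t| ≤ dist a b * exp (2 * t))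
    (hg : ∀ a b t, 0 ≤ t → |g a t - g b t| ≤ dist a b * exp (2 * t)) :
    IsOpen {a | ∃ t, 0 ≤ t ∧ (∀ s ∈ Icc 0 t, f a s < 0) ∧ 0 < g a t} := by
  rw [Metric.isOpen_iff]
  rintro a ⟨t, ht, hfa, hga⟩
  obtain ⟨m, hm, hmax⟩ := isCompact_Icc.exists_isMaxOn ⟨0, le_rfl, ht⟩ (hfc a).continuousOn
  have hδ : 0 < min (-f a m) (g a t) := lt_min (by linarith [hfa m hm]) hga
  refine ⟨min (-f a m) (g a t) / exp (2 * t), by positivity, fun b hb => ?_⟩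
  rw [Metric.mem_ball, lt_div_iff₀ (exp_pos _)] at hb
  have h1 := hb.trans_le (min_le_left _ _)
  have h2 := hb.trans_le (min_le_right _ _)
  refine ⟨t, ht, fun s hs => ?_, ?_⟩
  · have h3 := (abs_le.1 (hf b a s hs.1)).2
    have h4 : dist b a * exp (2 * s) ≤ dist b a * exp (2 * t) :=
      mul_le_mul_of_nonneg_left (exp_le_exp.2 (by linarith [hs.2])) dist_nonneg
    have h5 : f a s ≤ f a m := hmax hs
    linarith
  · have h3 := (abs_le.1 (hg b a t ht)).1
    linarith

/-- The ABC vector field is Lipschitz for the sup norm. -/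
lemma lipschitzWith_abcField : LipschitzWith 2 (fun p : ℝ × ℝ × ℝ =>
    (sin p.2.2 + cos p.2.1, sin p.1 + cos p.2.2, sin p.2.1 + cos p.1)) := by
  refine LipschitzWith.of_dist_le_mul fun p q => ?_
  have h1 : |p.1 - q.1| ≤ dist p q := by rw [← Real.dist_eq]; simp [Prod.dist_eq]
  have h2 : |p.2.1 - q.2.1| ≤ dist p q := by rw [← Real.dist_eq]; simp [Prod.dist_eq]
  have h3 : |p.2.2 - q.2.2| ≤ dist p q := by rw [← Real.dist_eq]; simp [Prod.dist_eq]
  have key : ∀ a b c d : ℝ, |a - b| ≤ dist p q → |c - d| ≤ dist p q →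
      dist (sin a + cos c) (sin b + cos d) ≤ 2 * dist p q := by
    intro a b c d hab hcd
    have e1 := (abs_sin_sub_sin_le a b).trans hab
    have e2 := (abs_cos_sub_cos_le c d).trans hcd
    rw [abs_le] at e1 e2
    rw [Real.dist_eq, abs_le]
    constructor <;> linarith [e1.1, e1.2, e2.1, e2.2]
  rw [Prod.dist_eq, Prod.dist_eq]
  exact max_le (key _ _ _ _ h3 h2) (max_le (key _ _ _ _ h1 h3) (key _ _ _ _ h2 h1))

namespace IsABCSol

variable {x y z : ℝ → ℝ}

lemma dist_le {x' y' z' : ℝ → ℝ} (h : IsABCSol x y z) (h' : IsABCSol x' y' z')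
    {t : ℝ} (ht : 0 ≤ t) :
    dist (x t, y t, z t) (x' t, y' t, z' t) ≤
      dist (x 0, y 0, z 0) (x' 0, y' 0, z' 0) * exp (2 * t) := by
  have hd : ∀ {u v w : ℝ → ℝ}, IsABCSol u v w → ∀ s, HasDerivAt (fun s => (u s, v s, w s))
      (sin (w s) + cos (v s), sin (u s) + cos (w s), sin (v s) + cos (u s)) s :=
    fun hs s => (hs s).1.prodMk ((hs s).2.1.prodMk (hs s).2.2)
  have := dist_le_of_trajectories_ODE (v := fun _ p => (sin p.2.2 + cos p.2.1,
      sin p.1 + cos p.2.2, sin p.2.1 + cos p.1)) (a := 0) (b := t) (K := 2)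
    (fun _ => lipschitzWith_abcField)
    (fun s _ => (hd h s).continuousAt.continuousWithinAt)
    (fun s _ => (hd h s).hasDerivWithinAt)
    (fun s _ => (hd h' s).continuousAt.continuousWithinAt)
    (fun s _ => (hd h' s).hasDerivWithinAt) le_rfl t ⟨ht, le_rfl⟩
  simpa using this

lemma hasDerivAt_x (h : IsABCSol x y z) (t : ℝ) : HasDerivAt x (sin (z t) + cos (y t)) t := (h t).1

lemma hasDerivAt_y (h : IsABCSol x y z) (t : ℝ) : HasDerivAt y (sin (x t) + cos (z t)) t :=
  (h t).2.1

lemma hasDerivAt_z (h : IsABCSol x y z) (t : ℝ) : HasDerivAt z (sin (y t) + cos (x t)) t :=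
  (h t).2.2

lemma continuous_x (h : IsABCSol x y z) : Continuous x :=
  continuous_iff_continuousAt.2 fun t => (h t).1.continuousAt

lemma continuous_z (h : IsABCSol x y z) : Continuous z :=
  continuous_iff_continuousAt.2 fun t => (h t).2.2.continuousAt

/-- The speed in the `z` direction is positive where `-π/2 < x + y`, `x < 0` and `y < π/4`. -/
lemma _root_.sin_add_cos_pos_of_mem_triangle {a b : ℝ} (hv : -(π / 2) < a + b) (ha : a ≤ 0)
    (hb : b ≤ π / 4) : 0 < sin b + cos a := by
  have hpi := pi_pos
  rw [← sin_add_pi_div_two, add_comm, sin_add_sin]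
  refine mul_pos (mul_pos two_pos (sin_pos_of_pos_of_lt_pi (by linarith) (by linarith)))
    (cos_pos_of_mem_Ioo ⟨by linarith, by linarith⟩)

lemma _root_.one_le_sin_add_cos {c : ℝ} (h0 : 0 ≤ c) (h1 : c ≤ π / 2) : 1 ≤ sin c + cos c := by
  have hs := sin_nonneg_of_nonneg_of_le_pi h0 (by linarith [pi_pos])
  have hc := cos_nonneg_of_mem_Icc (x := c) ⟨by linarith [pi_pos], h1⟩
  nlinarith [sin_sq_add_cos_sq c, mul_nonneg hs hc]

/-- As long as `x ≤ 0`, `z ≤ π/2` and `y < π/4`, the orbit stays on the side `-π/2 < x + y`. -/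
lemma neg_pi_div_two_lt_add (h : IsABCSol x y z) (hx0 : x 0 = -(π / 2)) (hy0 : y 0 = 0)
    (hz0 : 0 ≤ z 0) {T : ℝ} (hx : ∀ t ∈ Icc 0 T, x t ≤ 0) (hz : ∀ t ∈ Icc 0 T, z t ≤ π / 2)
    (hy : ∀ t ∈ Ioo 0 T, y t < π / 4) : ∀ t ∈ Ioc 0 T, -(π / 2) < x t + y t := by
  have hf : ∀ t, HasDerivAt (fun t => x t + y t + π / 2)
      ((sin (z t) + cos (y t)) + (sin (x t) + cos (z t))) t := fun t =>
    ((h.hasDerivAt_x t).add (h.hasDerivAt_y t)).add_const _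
  have := pos_of_barrier hf (T := T) (by simp [hx0, hy0]) ?_
  · intro t ht
    linarith [this t ht]
  intro t ht hpos hzero
  have hz0t : z 0 ≤ z t := le_of_hasDerivAt_nonneg h.hasDerivAt_z ht.1 fun s hs =>
    (sin_add_cos_pos_of_mem_triangle (by linarith [hpos s hs])
      (hx s ⟨hs.1.le, hs.2.le.trans ht.2⟩) (hy s ⟨hs.1, hs.2.trans_le ht.2⟩).le).le
  have h1 := one_le_sin_add_cos (hz0.trans hz0t) (hz t ht)
  have h2 : cos (y t) = - sin (x t) := by
    rw [← cos_add_pi_div_two, ← cos_neg]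
    congr 1
    linarith
  linarith

/-- Along orbits with `x ≤ 0` and `z ≤ π/2`, the quantity `x - cos x - sin y` is nondecreasing,
which keeps `y` below `π/4`. -/
lemma y_lt_pi_div_four (h : IsABCSol x y z) (hx0 : x 0 = -(π / 2)) (hy0 : y 0 = 0)
    (hz0 : 0 ≤ z 0) {T : ℝ} (hx : ∀ t ∈ Icc 0 T, x t ≤ 0) (hz : ∀ t ∈ Icc 0 T, z t ≤ π / 2) :
    ∀ t ∈ Ioc 0 T, y t < π / 4 := by
  have hpi := pi_pos
  have hf : ∀ t, HasDerivAt (fun t => π / 4 - y t) (-(sin (x t) + cos (z t))) t := fun t =>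
    (h.hasDerivAt_y t).const_sub _
  have := pos_of_barrier hf (T := T) (by simp [hy0]; positivity) ?_
  · intro t ht
    linarith [this t ht]
  intro t ht hpos hzero
  exfalso
  have hxt : ∀ s ∈ Icc 0 t, x s ≤ 0 := fun s hs => hx s ⟨hs.1, hs.2.trans ht.2⟩
  have hzt : ∀ s ∈ Icc 0 t, z s ≤ π / 2 := fun s hs => hz s ⟨hs.1, hs.2.trans ht.2⟩
  have hyt : ∀ s ∈ Ioo 0 t, y s < π / 4 := fun s hs => by linarith [hpos s hs]
  have hv := h.neg_pi_div_two_lt_add hx0 hy0 hz0 hxt hzt hyt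
  have hz' : ∀ s ∈ Icc 0 t, z 0 ≤ z s := fun s hs =>
    le_of_hasDerivAt_nonneg h.hasDerivAt_z hs.1 fun r hr =>
      have hr' : r < t := hr.2.trans_le hs.2
      (sin_add_cos_pos_of_mem_triangle (hv r ⟨hr.1, hr'.le⟩) (hxt r ⟨hr.1.le, hr'.le⟩)
        (hyt r ⟨hr.1, hr'⟩).le).le
  have hg : ∀ s, HasDerivAt (fun s => x s - cos (x s) - sin (y s))
      ((sin (z s) + cos (y s)) - -sin (x s) * (sin (z s) + cos (y s)) -
        cos (y s) * (sin (x s) + cos (z s))) s := fun s =>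
    ((h.hasDerivAt_x s).sub (h.hasDerivAt_x s).cos).sub (h.hasDerivAt_y s).sin
  have hmono := le_of_hasDerivAt_nonneg hg ht.1 fun s hs => by
    have hs' : s ∈ Icc 0 t := ⟨hs.1.le, hs.2.le⟩
    have h1 : 0 ≤ sin (z s) := sin_nonneg_of_nonneg_of_le_pi (hz0.trans (hz' s hs'))
      (by linarith [hzt s hs'])
    have h2 : 0 ≤ cos (y s) := cos_nonneg_of_mem_Icc
      ⟨by linarith [hv s ⟨hs.1, hs.2.le⟩, hxt s hs'], by linarith [hyt s hs]⟩
    have h3 := mul_nonneg (neg_le_iff_add_nonneg'.1 (neg_one_le_sin (x s))) h1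
    have h4 := mul_nonneg h2 (sub_nonneg.2 (cos_le_one (z s)))
    linarith
  have hgx : x t - cos (x t) ≤ -1 := by
    have hmono' := (abs_le.1 (abs_cos_sub_cos_le (x t) 0)).1
    rw [sub_zero, abs_of_nonpos (hx t ht), cos_zero] at hmono'
    linarith
  have hyeq : y t = π / 4 := by linarith
  simp only [hx0, hy0, hyeq, cos_neg, cos_pi_div_two, sin_zero, sin_pi_div_four] at hmono
  have hsqrt : (1.4 : ℝ) ≤ √2 := Real.le_sqrt_of_sq_le (by norm_num)
  linarith [pi_lt_d2]

/-- The `z` coordinate increases strictly while the orbit has `x ≤ 0` and `z ≤ π/2`. -/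
lemma z_lt_z (h : IsABCSol x y z) (hx0 : x 0 = -(π / 2)) (hy0 : y 0 = 0)
    (hz0 : 0 ≤ z 0) {T : ℝ} (hx : ∀ t ∈ Icc 0 T, x t ≤ 0) (hz : ∀ t ∈ Icc 0 T, z t ≤ π / 2)
    {s t : ℝ} (hs : 0 ≤ s) (hst : s < t) (htT : t ≤ T) : z s < z t := by
  have hy := h.y_lt_pi_div_four hx0 hy0 hz0 hx hz
  have hv := h.neg_pi_div_two_lt_add hx0 hy0 hz0 hx hz fun t ht => hy t ⟨ht.1, ht.2.le⟩
  refine lt_of_hasDerivAt_pos h.hasDerivAt_z hst fun r hr => ?_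
  have hr0 : 0 < r := hs.trans_lt hr.1
  have hrT : r ≤ T := hr.2.le.trans htT
  exact sin_add_cos_pos_of_mem_triangle (hv r ⟨hr0, hrT⟩) (hx r ⟨hr0.le, hrT⟩) (hy r ⟨hr0, hrT⟩).le

/-- The speed in the `x` direction is at least `sin z` while `x ≤ 0` and `z ≤ π/2`. -/
lemma deriv_x_ge (h : IsABCSol x y z) (hx0 : x 0 = -(π / 2)) (hy0 : y 0 = 0)
    (hz0 : 0 ≤ z 0) {T : ℝ} (hx : ∀ t ∈ Icc 0 T, x t ≤ 0) (hz : ∀ t ∈ Icc 0 T, z t ≤ π / 2)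
    {t : ℝ} (ht : t ∈ Ioc 0 T) : sin (z t) ≤ sin (z t) + cos (y t) := by
  have hy := h.y_lt_pi_div_four hx0 hy0 hz0 hx hz
  have hv := h.neg_pi_div_two_lt_add hx0 hy0 hz0 hx hz fun t ht => hy t ⟨ht.1, ht.2.le⟩
  have := cos_nonneg_of_mem_Icc (x := y t)
    ⟨by linarith [hv t ht, hx t ⟨ht.1.le, ht.2⟩], by linarith [hy t ht, pi_pos]⟩
  linarith

/-- The orbit leaves `{x < 0, z < π/2}` at some first positive time. -/
lemma exists_exit_time (h : IsABCSol x y z) (hx0 : x 0 = -(π / 2)) (hy0 : y 0 = 0)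
    (hz0 : 0 ≤ z 0) (hz1 : z 0 < π / 2) :
    ∃ T > 0, (∀ t ∈ Ico 0 T, x t < 0 ∧ z t < π / 2) ∧ (∀ t ∈ Icc 0 T, x t ≤ 0) ∧
      (∀ t ∈ Icc 0 T, z t ≤ π / 2) ∧ (x T = 0 ∨ z T = π / 2) := by
  have hpi := pi_pos
  have hexit : ∃ t, 0 ≤ t ∧ (0 ≤ x t ∨ π / 2 ≤ z t) := by
    by_contra! hcon
    have hx : ∀ T, ∀ t ∈ Icc 0 T, x t ≤ 0 := fun T t ht => (hcon t ht.1).1.le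
    have hz : ∀ T, ∀ t ∈ Icc 0 T, z t ≤ π / 2 := fun T t ht => (hcon t ht.1).2.le
    have hz1pos : 0 < z 1 :=
      hz0.trans_lt (h.z_lt_z hx0 hy0 hz0 (hx 1) (hz 1) le_rfl one_pos le_rfl)
    set c := sin (z 1) with hc
    have hcpos : 0 < c := sin_pos_of_pos_of_lt_pi hz1pos (by linarith [hz 1 1 (by simp)])
    have hlt : 1 ≤ 1 + (-x 1) / c := by
      have := div_nonneg (neg_nonneg.2 (hcon 1 zero_le_one).1.le) hcpos.le
      linarith
    have hg : ∀ t, HasDerivAt (fun t => x t - t * c) (sin (z t) + cos (y t) - 1 * c) t := fun t =>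
      (h.hasDerivAt_x t).sub ((hasDerivAt_id t).mul_const c)
    have hmono := le_of_hasDerivAt_nonneg hg hlt fun t ht => by
      have ht0 : 0 < t := one_pos.trans ht.1
      have h1 := h.deriv_x_ge hx0 hy0 hz0 (hx t) (hz t) ⟨ht0, le_rfl⟩
      have h2 := h.z_lt_z hx0 hy0 hz0 (hx t) (hz t) zero_le_one ht.1 le_rfl
      have h3 : c ≤ sin (z t) :=
        sin_le_sin_of_le_of_le_pi_div_two (by linarith) (hcon t ht0.le).2.le h2.le
      linarith
    have hend := (hcon (1 + (-x 1) / c) (by linarith)).1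
    have : (1 + (-x 1) / c) * c = c - x 1 := by field_simp; ring
    simp only [this] at hmono
    linarith
  obtain ⟨t, ht, hbad⟩ := hexit
  have hclosed : IsClosed {t | 0 ≤ x t ∨ π / 2 ≤ z t} :=
    (isClosed_le continuous_const h.continuous_x).union
      (isClosed_le continuous_const h.continuous_z)
  obtain ⟨T, hT, hTbad, hmin⟩ := exists_first_time hclosed ht hbad
  have hTpos : 0 < T := by
    refine lt_of_le_of_ne hT.1 fun h0 => ?_
    rw [← h0, hx0] at hTbad
    rcases hTbad with h | h <;> linarith
  have hin : ∀ t ∈ Ico 0 T, x t < 0 ∧ z t < π / 2 := fun s hs => by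
    have := hmin s hs
    push Not at this
    exact this
  have hxT : x T ≤ 0 := by
    refine le_of_tendsto ((h.continuous_x.tendsto T).mono_left
      (nhdsWithin_le_nhds (s := Iio T))) ?_
    filter_upwards [Ioo_mem_nhdsLT hTpos] with s hs using (hin s ⟨hs.1.le, hs.2⟩).1.le
  have hzT : z T ≤ π / 2 := by
    refine le_of_tendsto ((h.continuous_z.tendsto T).mono_left
      (nhdsWithin_le_nhds (s := Iio T))) ?_
    filter_upwards [Ioo_mem_nhdsLT hTpos] with s hs using (hin s ⟨hs.1.le, hs.2⟩).2.le
  refine ⟨T, hTpos, hin, fun s hs => ?_, fun s hs => ?_, ?_⟩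
  · rcases hs.2.eq_or_lt with rfl | hlt
    exacts [hxT, (hin s ⟨hs.1, hlt⟩).1.le]
  · rcases hs.2.eq_or_lt with rfl | hlt
    exacts [hzT, (hin s ⟨hs.1, hlt⟩).2.le]
  · exact hTbad.imp (le_antisymm hxT) (le_antisymm hzT)

/-- Starting from height `0`, the orbit satisfies `z < x + π/2`. -/
lemma z_lt_x_add (h : IsABCSol x y z) (hx0 : x 0 = -(π / 2)) (hy0 : y 0 = 0)
    (hz0 : z 0 = 0) {T : ℝ} (hx : ∀ t ∈ Icc 0 T, x t ≤ 0) (hz : ∀ t ∈ Icc 0 T, z t ≤ π / 2) :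
    ∀ t ∈ Ioc 0 T, z t < x t + π / 2 := by
  have hpi := pi_pos
  have hy := h.y_lt_pi_div_four hx0 hy0 hz0.ge hx hz
  have hv := h.neg_pi_div_two_lt_add hx0 hy0 hz0.ge hx hz fun t ht => hy t ⟨ht.1, ht.2.le⟩
  have hf : ∀ t, HasDerivAt (fun t => x t + π / 2 - z t)
      ((sin (z t) + cos (y t)) - (sin (y t) + cos (x t))) t := fun t =>
    ((h.hasDerivAt_x t).add_const _).sub (h.hasDerivAt_z t)
  have := pos_of_barrier hf (T := T) (by simp [hx0, hz0]) ?_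
  · intro t ht
    linarith [this t ht]
  intro t ht _ hzero
  have hyI : -(π / 2) < y t ∧ y t < π / 4 := by
    rcases ht.1.eq_or_lt with rfl | h0
    · rw [hy0]
      constructor <;> linarith
    · exact ⟨by linarith [hv t ⟨h0, ht.2⟩, hx t ht], hy t ⟨h0, ht.2⟩⟩
  have hcx : cos (x t) = sin (z t) := by
    rw [← sin_add_pi_div_two]
    congr 1
    linarith
  have hlt : sin (y t) < cos (y t) := by
    rcases le_total (y t) 0 with hn | hp
    · exact (sin_nonpos_of_nonpos_of_neg_pi_le hn (by linarith)).trans_lt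
        (cos_pos_of_mem_Ioo ⟨hyI.1, by linarith⟩)
    · rw [← sin_pi_div_two_sub]
      exact sin_lt_sin_of_lt_of_le_pi_div_two hyI.1.le (by linarith) (by linarith)
  linarith

/-- An orbit with `z 0 = π/2 - 1/20` cannot satisfy `x ≤ 0` and `z < π/2` on all of `[0, 1/2]`. -/
lemma pi_div_two_le_z_half (h : IsABCSol x y z) (hx0 : x 0 = -(π / 2)) (hy0 : y 0 = 0)
    (hz0 : z 0 = π / 2 - 1 / 20) (hx : ∀ t ∈ Icc 0 (1 / 2), x t ≤ 0)
    (hz : ∀ t ∈ Icc 0 (1 / 2), z t ≤ π / 2) : π / 2 ≤ z (1 / 2) := by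
  have hpi := pi_gt_three
  have hpi' := pi_lt_d2
  have hz0' : 0 ≤ z 0 := by linarith
  have hy := h.y_lt_pi_div_four hx0 hy0 hz0' hx hz
  have hv := h.neg_pi_div_two_lt_add hx0 hy0 hz0' hx hz fun t ht => hy t ⟨ht.1, ht.2.le⟩
  have hzge : ∀ t ∈ Ioc 0 (1 / 2), z 0 < z t := fun t ht =>
    h.z_lt_z hx0 hy0 hz0' hx hz le_rfl ht.1 ht.2
  have hdiff : ∀ t, HasDerivAt (fun t => x t - y t)
      ((sin (z t) + cos (y t)) - (sin (x t) + cos (z t))) t := fun t =>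
    (h.hasDerivAt_x t).sub (h.hasDerivAt_y t)
  have hsum : ∀ t, HasDerivAt (fun t => x t + y t)
      ((sin (z t) + cos (y t)) + (sin (x t) + cos (z t))) t := fun t =>
    (h.hasDerivAt_x t).add (h.hasDerivAt_y t)
  have hdiff_lower : ∀ t ∈ Icc 0 (1 / 2), -(π / 2) ≤ x t - y t := by
    intro t ht
    have := le_of_hasDerivAt_nonneg hdiff ht.1 fun s hs => by
      have hs' : s ∈ Ioc 0 (1 / 2) := ⟨hs.1, hs.2.le.trans ht.2⟩
      have h1 := h.deriv_x_ge hx0 hy0 hz0' hx hz hs'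
      have h2 : sin (x s) ≤ 0 := sin_nonpos_of_nonpos_of_neg_pi_le (hx s ⟨hs'.1.le, hs'.2⟩)
        (by linarith [hv s hs', hy s hs'])
      have h3 : cos (z s) ≤ sin (z s) := by
        rw [← sin_pi_div_two_sub]
        have := hzge s hs'
        exact sin_le_sin_of_le_of_le_pi_div_two (by linarith [hz s ⟨hs'.1.le, hs'.2⟩])
          (hz s ⟨hs'.1.le, hs'.2⟩) (by linarith)
      linarith
    simp only [hx0, hy0] at this
    linarith
  have hdiff_upper : ∀ t ∈ Icc 0 (1 / 2), x t - y t ≤ -(π / 2) + 3 * t := by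
    intro t ht
    have hg : ∀ t, HasDerivAt (fun t => t * 3 - (x t - y t))
        (1 * 3 - ((sin (z t) + cos (y t)) - (sin (x t) + cos (z t)))) t := fun t =>
      ((hasDerivAt_id t).mul_const 3).sub (hdiff t)
    have := le_of_hasDerivAt_nonneg hg ht.1 fun s hs => by
      have hs' : s ∈ Ioc 0 (1 / 2) := ⟨hs.1, hs.2.le.trans ht.2⟩
      have hzs := hz s ⟨hs'.1.le, hs'.2⟩
      have h1 := cos_nonneg_of_mem_Icc (x := z s) ⟨by linarith [hzge s hs'], hzs⟩
      linarith [sin_le_one (z s), cos_le_one (y s), neg_one_le_sin (x s)]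
    simp only [hx0, hy0] at this
    linarith
  have hsum_lower : ∀ t ∈ Icc 0 (1 / 2), -(π / 2) + t ≤ x t + y t := by
    intro t ht
    have hg : ∀ t, HasDerivAt (fun t => x t + y t - t)
        ((sin (z t) + cos (y t)) + (sin (x t) + cos (z t)) - 1) t := fun t =>
      (hsum t).sub (hasDerivAt_id t)
    have := le_of_hasDerivAt_nonneg hg ht.1 fun s hs => by
      have hs' : s ∈ Ioc 0 (1 / 2) := ⟨hs.1, hs.2.le.trans ht.2⟩
      have hs'' : s ∈ Icc 0 (1 / 2) := ⟨hs'.1.le, hs'.2⟩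
      have h1 := one_le_sin_add_cos (by linarith [hzge s hs']) (hz s hs'')
      have h2 : cos (x s + π / 2) ≤ cos (y s) := by
        rw [← cos_abs (y s)]
        refine cos_le_cos_of_nonneg_of_le_pi (abs_nonneg _) (by linarith [hx s hs'']) ?_
        exact abs_le.2 ⟨by linarith [hv s hs'], by linarith [hdiff_lower s hs'']⟩
      rw [cos_add_pi_div_two] at h2
      linarith
    simp only [hx0, hy0] at this
    linarith
  have hg : ∀ t, HasDerivAt (fun t => z t - t ^ 2 * (1 / 5))
      ((sin (y t) + cos (x t)) - ((2 : ℕ) * t ^ (2 - 1)) * (1 / 5)) t := fun t =>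
    (h.hasDerivAt_z t).sub ((hasDerivAt_pow 2 t).mul_const _)
  have hmono := le_of_hasDerivAt_nonneg hg (by norm_num : (0 : ℝ) ≤ 1 / 2) fun t ht => by
    have ht' : t ∈ Icc (0 : ℝ) (1 / 2) := ⟨ht.1.le, ht.2.le⟩
    have hyt := hy t ⟨ht.1, ht.2.le⟩
    have hl := hsum_lower t ht'
    have hd1 := hdiff_lower t ht'
    have hd2 := hdiff_upper t ht'
    have e : sin (y t) + cos (x t) =
        2 * sin ((x t + π / 2 + y t) / 2) * cos ((x t + π / 2 - y t) / 2) := by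
      rw [← sin_add_sin, sin_add_pi_div_two, add_comm]
    have hsin : t / π ≤ sin ((x t + π / 2 + y t) / 2) := by
      refine le_trans ?_ (mul_le_sin (by linarith [ht.1]) (by linarith [hx t ht']))
      rw [div_mul_div_comm, div_le_div_iff₀ (by positivity) (by positivity)]
      nlinarith
    have hcos : 7 / 10 ≤ cos ((x t + π / 2 - y t) / 2) := by
      refine le_trans ?_ (one_sub_sq_div_two_le_cos)
      have h1 : 0 ≤ (x t + π / 2 - y t) / 2 := by linarith
      have h2 : (x t + π / 2 - y t) / 2 ≤ 3 / 4 := by linarith [ht.2]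
      nlinarith
    have hdiv : 3 / 10 * t ≤ t / π := by
      rw [le_div_iff₀ pi_pos]
      nlinarith [ht.1]
    have hprod := mul_le_mul (hdiv.trans hsin) hcos (by norm_num)
      ((mul_nonneg (by norm_num) ht.1.le).trans (hdiv.trans hsin))
    rw [e]
    norm_num
    linarith [ht.1]
  simp only [hz0] at hmono
  linarith

/-- An orbit reaching `x = 0` strictly below `z = π/2` crosses `x = 0` there. -/
lemma exists_crosses_x (h : IsABCSol x y z) (hx0 : x 0 = -(π / 2)) (hy0 : y 0 = 0)
    (hz0 : 0 ≤ z 0) {T : ℝ} (hT : 0 < T) (hx : ∀ t ∈ Icc 0 T, x t ≤ 0)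
    (hz : ∀ t ∈ Icc 0 T, z t < π / 2) (hxT : x T = 0) :
    ∃ t, 0 ≤ t ∧ (∀ s ∈ Icc 0 t, z s - π / 2 < 0) ∧ 0 < x t := by
  have hz' : ∀ t ∈ Icc 0 T, z t ≤ π / 2 := fun t ht => (hz t ht).le
  have hzpos := hz0.trans_lt (h.z_lt_z hx0 hy0 hz0 hx hz' le_rfl hT le_rfl)
  have hd := (sin_pos_of_pos_of_lt_pi hzpos (by linarith [hz T ⟨hT.le, le_rfl⟩, pi_pos])).trans_le
    (h.deriv_x_ge hx0 hy0 hz0 hx hz' ⟨hT, le_rfl⟩)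
  obtain ⟨ε, hε, hsub⟩ := mem_nhdsGT_iff_exists_Ioo_subset.1
    (((h.continuous_z.tendsto T).eventually (eventually_lt_nhds (hz T ⟨hT.le, le_rfl⟩))
      |>.filter_mono nhdsWithin_le_nhds).and
        (eventually_pos_right_of_hasDerivAt (h.hasDerivAt_x T) hd hxT))
  have hε' : T < ε := hε
  refine ⟨(T + ε) / 2, by linarith, fun s hs => ?_, (hsub ⟨by linarith, by linarith⟩).2⟩
  rcases le_or_gt s T with hsT | hsT
  · linarith [hz s ⟨hs.1, hsT⟩]
  · linarith [(hsub ⟨hsT, by linarith [hs.2]⟩ : _ ∧ _).1]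

/-- An orbit reaching `z = π/2` strictly before `x = 0` crosses `z = π/2` there. -/
lemma exists_crosses_z (h : IsABCSol x y z) (hx0 : x 0 = -(π / 2)) (hy0 : y 0 = 0)
    (hz0 : 0 ≤ z 0) {T : ℝ} (hT : 0 < T) (hx : ∀ t ∈ Icc 0 T, x t < 0)
    (hz : ∀ t ∈ Icc 0 T, z t ≤ π / 2) (hzT : z T = π / 2) :
    ∃ t, 0 ≤ t ∧ (∀ s ∈ Icc 0 t, x s < 0) ∧ 0 < z t - π / 2 := by
  have hx' : ∀ t ∈ Icc 0 T, x t ≤ 0 := fun t ht => (hx t ht).le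
  have hy := h.y_lt_pi_div_four hx0 hy0 hz0 hx' hz
  have hv := h.neg_pi_div_two_lt_add hx0 hy0 hz0 hx' hz fun t ht => hy t ⟨ht.1, ht.2.le⟩
  have hd := sin_add_cos_pos_of_mem_triangle (hv T ⟨hT, le_rfl⟩) (hx' T ⟨hT.le, le_rfl⟩)
    (hy T ⟨hT, le_rfl⟩).le
  obtain ⟨ε, hε, hsub⟩ := mem_nhdsGT_iff_exists_Ioo_subset.1
    (((h.continuous_x.tendsto T).eventually (eventually_lt_nhds (hx T ⟨hT.le, le_rfl⟩))
      |>.filter_mono nhdsWithin_le_nhds).and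
        (eventually_pos_right_of_hasDerivAt ((h.hasDerivAt_z T).sub_const (π / 2)) hd
          (by simp [hzT])))
  have hε' : T < ε := hε
  refine ⟨(T + ε) / 2, by linarith, fun s hs => ?_, (hsub ⟨by linarith, by linarith⟩).2⟩
  rcases le_or_gt s T with hsT | hsT
  · exact hx s ⟨hs.1, hsT⟩
  · exact (hsub ⟨hsT, by linarith [hs.2]⟩ : _ ∧ _).1

/-- An orbit either crosses `x = 0` before `z = π/2`, or crosses `z = π/2` before `x = 0`, or
reaches the edge `x = 0`, `z = π/2` from inside the prism. -/
lemma crosses_or_reaches_edge (h : IsABCSol x y z) (hx0 : x 0 = -(π / 2)) (hy0 : y 0 = 0)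
    (hz0 : 0 ≤ z 0) (hz1 : z 0 < π / 2) :
    (∃ t, 0 ≤ t ∧ (∀ s ∈ Icc 0 t, z s - π / 2 < 0) ∧ 0 < x t) ∨
    (∃ t, 0 ≤ t ∧ (∀ s ∈ Icc 0 t, x s < 0) ∧ 0 < z t - π / 2) ∨
    ∃ T > (0 : ℝ), (∀ t ∈ Ioo 0 T, (x t, y t, z t) ∈ prismD) ∧
      x T = 0 ∧ z T = π / 2 ∧ y T ∈ Icc (-(π / 2)) (π / 4) := by
  obtain ⟨T, hT, hin, hx, hz, hexit⟩ := h.exists_exit_time hx0 hy0 hz0 hz1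
  have hTmem : T ∈ Icc 0 T := ⟨hT.le, le_rfl⟩
  rcases (hz T hTmem).lt_or_eq with hzT | hzT
  · refine Or.inl (h.exists_crosses_x hx0 hy0 hz0 hT hx (fun t ht => ?_)
      (hexit.resolve_right hzT.ne))
    rcases ht.2.eq_or_lt with rfl | hlt
    exacts [hzT, (hin t ⟨ht.1, hlt⟩).2]
  rcases (hx T hTmem).lt_or_eq with hxT | hxT
  · refine Or.inr (Or.inl (h.exists_crosses_z hx0 hy0 hz0 hT (fun t ht => ?_) hz hzT))
    rcases ht.2.eq_or_lt with rfl | hlt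
    exacts [hxT, (hin t ⟨ht.1, hlt⟩).1]
  have hy := h.y_lt_pi_div_four hx0 hy0 hz0 hx hz
  have hv := h.neg_pi_div_two_lt_add hx0 hy0 hz0 hx hz fun t ht => hy t ⟨ht.1, ht.2.le⟩
  refine Or.inr (Or.inr ⟨T, hT, fun t ht => ?_, hxT, hzT, ?_, (hy T ⟨hT, le_rfl⟩).le⟩)
  · have ht' : t ∈ Ioc 0 T := ⟨ht.1, ht.2.le⟩
    have hin' := hin t ⟨ht.1.le, ht.2⟩
    exact ⟨⟨hv t ht', by linarith [hv t ht', hy t ht', pi_pos], hin'.1⟩,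
      hz0.trans_lt (h.z_lt_z hx0 hy0 hz0 hx hz le_rfl ht.1 ht.2.le), hin'.2⟩
  · linarith [hv T ⟨hT, le_rfl⟩]

/-- The orbit starting at height `0` crosses `x = 0` below `z = π/2`. -/
lemma crosses_x_of_z_zero (h : IsABCSol x y z) (hx0 : x 0 = -(π / 2)) (hy0 : y 0 = 0)
    (hz0 : z 0 = 0) : ∃ t, 0 ≤ t ∧ (∀ s ∈ Icc 0 t, z s - π / 2 < 0) ∧ 0 < x t := by
  obtain ⟨T, hT, hin, hx, hz, hexit⟩ :=
    h.exists_exit_time hx0 hy0 hz0.ge (by rw [hz0]; positivity)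
  have hw := h.z_lt_x_add hx0 hy0 hz0 hx hz
  have hzT : z T < π / 2 := by linarith [hw T ⟨hT, le_rfl⟩, hx T ⟨hT.le, le_rfl⟩]
  refine h.exists_crosses_x hx0 hy0 hz0.ge hT hx (fun t ht => ?_) (hexit.resolve_right hzT.ne)
  rcases ht.2.eq_or_lt with rfl | hlt
  exacts [hzT, (hin t ⟨ht.1, hlt⟩).2]

/-- The orbit starting at height `π/2 - 1/20` crosses `z = π/2` before `x = 0`. -/
lemma crosses_z_of_z_near (h : IsABCSol x y z) (hx0 : x 0 = -(π / 2)) (hy0 : y 0 = 0)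
    (hz0 : z 0 = π / 2 - 1 / 20) :
    ∃ t, 0 ≤ t ∧ (∀ s ∈ Icc 0 t, x s < 0) ∧ 0 < z t - π / 2 := by
  have hpi := pi_gt_three
  have hz0' : 0 ≤ z 0 := by linarith
  obtain ⟨T, hT, hin, hx, hz, hexit⟩ := h.exists_exit_time hx0 hy0 hz0' (by linarith)
  have hT2 : T ≤ 1 / 2 := by
    by_contra! hlt
    have := h.pi_div_two_le_z_half hx0 hy0 hz0 (fun t ht => hx t ⟨ht.1, ht.2.trans hlt.le⟩)
      (fun t ht => hz t ⟨ht.1, ht.2.trans hlt.le⟩)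
    linarith [(hin (1 / 2) ⟨by norm_num, hlt⟩).2]
  have hxT : x T < 0 := by
    have hg : ∀ t, HasDerivAt (fun t => t * 2 - x t) (1 * 2 - (sin (z t) + cos (y t))) t :=
      fun t => ((hasDerivAt_id t).mul_const 2).sub (h.hasDerivAt_x t)
    have := le_of_hasDerivAt_nonneg hg hT.le fun s _ => by
      linarith [sin_le_one (z s), cos_le_one (y s)]
    simp only [hx0] at this
    linarith
  refine h.exists_crosses_z hx0 hy0 hz0' hT (fun t ht => ?_) hz (hexit.resolve_left hxT.ne)
  rcases ht.2.eq_or_lt with rfl | hlt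
  exacts [hxT, (hin t ⟨ht.1, hlt⟩).1]

end IsABCSol

theorem stmt14 :
    ∃ a ∈ Set.Ico (0 : ℝ) (π / 2), ∀ x y z : ℝ → ℝ, IsABCSol x y z →
      x 0 = -(π / 2) → y 0 = 0 → z 0 = a →
      ∃ tstar > (0 : ℝ), (∀ t ∈ Set.Ioo 0 tstar, (x t, y t, z t) ∈ prismD) ∧
        x tstar = 0 ∧ z tstar = π / 2 ∧ y tstar ∈ Set.Icc (-(π / 2)) (π / 4) := by
  by_contra hcon
  have hpi := pi_gt_three
  have hle : (0 : ℝ) ≤ π / 2 - 1 / 20 := by linarith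
  have hmem : ∀ a : Icc (0 : ℝ) (π / 2 - 1 / 20), (a : ℝ) ∈ Ico (0 : ℝ) (π / 2) :=
    fun a => ⟨a.2.1, by linarith [a.2.2]⟩
  have hex : ∀ a : Icc (0 : ℝ) (π / 2 - 1 / 20), ∃ x y z : ℝ → ℝ, IsABCSol x y z ∧
      x 0 = -(π / 2) ∧ y 0 = 0 ∧ z 0 = a ∧
      ¬ ∃ T > (0 : ℝ), (∀ t ∈ Ioo 0 T, (x t, y t, z t) ∈ prismD) ∧
        x T = 0 ∧ z T = π / 2 ∧ y T ∈ Icc (-(π / 2)) (π / 4) := by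
    intro a
    by_contra hn
    refine hcon ⟨a, hmem a, fun x y z h hx hy hz => ?_⟩
    by_contra hT
    exact hn ⟨x, y, z, h, hx, hy, hz, hT⟩
  choose x y z h hx0 hy0 hz0 hno using hex
  have hdist : ∀ a b t, 0 ≤ t →
      dist (x a t, y a t, z a t) (x b t, y b t, z b t) ≤ dist a b * exp (2 * t) := by
    intro a b t ht
    have := (h a).dist_le (h b) ht
    simpa [hx0, hy0, hz0, Prod.dist_eq, Subtype.dist_eq] using this
  have hxdist : ∀ a b t, 0 ≤ t → |x a t - x b t| ≤ dist a b * exp (2 * t) := fun a b t ht =>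
    (by rw [← Real.dist_eq]; simp [Prod.dist_eq] :
      |x a t - x b t| ≤ dist (x a t, y a t, z a t) (x b t, y b t, z b t)).trans (hdist a b t ht)
  have hzdist : ∀ a b t, 0 ≤ t → |(z a t - π / 2) - (z b t - π / 2)| ≤ dist a b * exp (2 * t) :=
    fun a b t ht =>
      (by rw [sub_sub_sub_cancel_right, ← Real.dist_eq]; simp [Prod.dist_eq] :
        |(z a t - π / 2) - (z b t - π / 2)| ≤
          dist (x a t, y a t, z a t) (x b t, y b t, z b t)).trans (hdist a b t ht)
  have hPopen := isOpen_setOf_crosses (fun a => (h a).continuous_z.sub continuous_const)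
    hzdist hxdist
  have hQopen := isOpen_setOf_crosses (fun a => (h a).continuous_x) hxdist hzdist
  have : PreconnectedSpace (Icc (0 : ℝ) (π / 2 - 1 / 20)) :=
    Subtype.preconnectedSpace isPreconnected_Icc
  obtain ⟨a, -, ⟨t, ht, hzt, hxt⟩, ⟨s, hs, hxs, hzs⟩⟩ := isPreconnected_univ _ _ hPopen hQopen
    (fun a _ => by
      rcases (h a).crosses_or_reaches_edge (hx0 a) (hy0 a) (by rw [hz0]; exact (hmem a).1)
        (by rw [hz0]; exact (hmem a).2) with hP | hQ | hR
      exacts [Or.inl hP, Or.inr hQ, absurd hR (hno a)])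
    ⟨⟨0, le_rfl, hle⟩, trivial, (h _).crosses_x_of_z_zero (hx0 _) (hy0 _) (hz0 _)⟩
    ⟨⟨π / 2 - 1 / 20, hle, le_rfl⟩, trivial, (h _).crosses_z_of_z_near (hx0 _) (hy0 _) (hz0 _)⟩
  rcases le_total t s with hts | hst
  · exact absurd (hxs t ⟨ht, hts⟩) (not_lt.2 hxt.le)
  · exact absurd (hzt s ⟨hs, hst⟩) (not_lt.2 hzs.le)
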